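/- Let φ be a K^# formula of modal depth m, and for each subformula ψ of φ let p_ψ be a distinct fresh atomic proposition not occurring in φ. For each subformula ψ define ψ' as follows: if ψ is an atomic proposition then ψ' = ψ; if ψ = ¬θ then ψ' = ¬p_θ; if ψ = θ∨θ'' then ψ' = p_θ ∨ p_{θ''}; if ψ = (ξ ≥ 0) then ψ' is obtained from ψ by replacing every occurrence of 1_θ in ξ by 1_{p_θ} and every occurrence of #θ in ξ by #p_θ. Then φ is satisfiable if and only if the formula p_φ ∧ ⋀_{ψ ∈ sub(φ)} □^{≤m}(p_ψ ↔ ψ') is satisfiable. -/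

import Mathlib

/-- A labeled directed graph: finite vertex set, directed edges, and a
labeling of each vertex by a valuation over atomic propositions (ℕ). -/
structure PGraph where
  V : Type
  fintV : Fintype V
  decV : DecidableEq V
  E : V → V → Bool
  label : V → ℕ → Bool

attribute [instance] PGraph.fintV PGraph.decV

mutual
/-- Formulas of the logic K^#. -/
inductive KForm : Type where
  | atom : ℕ → KForm
  | neg : KForm → KForm
  | or : KForm → KForm → KForm
  | geq : KExpr → KForm          -- ξ ≥ 0
/-- Arithmetic expressions of the logic K^#. -/
inductive KExpr : Type where
  | const : ℤ → KExpr
  | one : KForm → KExpr          -- 1_φ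
  | count : KForm → KExpr        -- #φ
  | add : KExpr → KExpr → KExpr
  | mul : ℤ → KExpr → KExpr      -- c × ξ
end

mutual
/-- Truth of a K^# formula at a pointed graph. -/
def KForm.eval (G : PGraph) : G.V → KForm → Bool
  | u, .atom p => G.label u p
  | u, .neg φ => !(KForm.eval G u φ)
  | u, .or φ ψ => KForm.eval G u φ || KForm.eval G u ψ
  | u, .geq ξ => decide (0 ≤ KExpr.eval G u ξ)
/-- Value of a K^# arithmetic expression at a pointed graph. -/
def KExpr.eval (G : PGraph) : G.V → KExpr → ℤ
  | _, .const c => c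
  | u, .one φ => if KForm.eval G u φ then 1 else 0
  | u, .count φ =>
      ((Finset.univ.filter (fun v => G.E u v && KForm.eval G v φ = true)).card : ℤ)
  | u, .add ξ ξ' => KExpr.eval G u ξ + KExpr.eval G u ξ'
  | u, .mul c ξ => c * KExpr.eval G u ξ
end

def KForm.satisfiable (φ : KForm) : Prop := ∃ (G : PGraph) (u : G.V), φ.eval G u = true

def KForm.valid (φ : KForm) : Prop := ∀ (G : PGraph) (u : G.V), φ.eval G u = true

/-- Truncated ReLU. -/
noncomputable def trunc (x : ℝ) : ℝ := max 0 (min 1 x)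

/-- A GNN: `L` layers; layer `t` (for `0 ≤ t < L`) has integer matrices
`C t`, `A t` and integer bias `b t`, mapping states of dimension `dim t` to
states of dimension `dim (t+1)`; `a` gives the integer coefficients of the
final linear classification function. The initial dimension `dim 0` is the
number of atomic propositions used. -/
structure GNN where
  L : ℕ
  dim : ℕ → ℕ
  C : (t : ℕ) → Matrix (Fin (dim t)) (Fin (dim (t + 1))) ℤ
  A : (t : ℕ) → Matrix (Fin (dim t)) (Fin (dim (t + 1))) ℤ
  b : (t : ℕ) → Fin (dim (t + 1)) → ℤ
  a : Fin (dim L) → ℤ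

/-- The state of a GNN on a graph after `t` layers. -/
noncomputable def GNN.state (N : GNN) (G : PGraph) : (t : ℕ) → G.V → Fin (N.dim t) → ℝ
  | 0, u, i => if G.label u i then 1 else 0
  | t + 1, u, j => trunc (
      (∑ i, N.state G t u i * (N.C t i j : ℝ)) +
      (∑ i, (∑ v ∈ Finset.univ.filter (fun v => G.E u v = true), N.state G t v i)
            * (N.A t i j : ℝ)) +
      (N.b t j : ℝ))

/-- The GNN accepts a pointed graph iff `cls(x_L(u)) = 1`, i.e. `Σ a_i x_i ≥ 1`. -/
noncomputable def GNN.accepts (N : GNN) (G : PGraph) (u : G.V) : Prop :=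
  1 ≤ ∑ i, (N.a i : ℝ) * N.state G N.L u i

mutual
/-- Modal depth of a K^# formula. -/
def KForm.md : KForm → ℕ
  | .atom _ => 0
  | .neg φ => φ.md
  | .or φ ψ => max φ.md ψ.md
  | .geq ξ => ξ.md
/-- Modal depth of a K^# expression. -/
def KExpr.md : KExpr → ℕ
  | .const _ => 0
  | .one φ => φ.md
  | .count φ => φ.md + 1
  | .add ξ ξ' => max ξ.md ξ'.md
  | .mul _ ξ => ξ.md
end

mutual
/-- Size (number of syntax-tree nodes) of a K^# formula. -/
def KForm.size : KForm → ℕ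
  | .atom _ => 1
  | .neg φ => φ.size + 1
  | .or φ ψ => φ.size + ψ.size + 1
  | .geq ξ => ξ.size + 1
/-- Size (number of syntax-tree nodes) of a K^# expression. -/
def KExpr.size : KExpr → ℕ
  | .const _ => 1
  | .one φ => φ.size + 1
  | .count φ => φ.size + 1
  | .add ξ ξ' => ξ.size + ξ'.size + 1
  | .mul _ ξ => ξ.size + 2
end

mutual
/-- Atomic propositions occurring in a K^# formula. -/
def KForm.atoms : KForm → Finset ℕ
  | .atom p => {p}
  | .neg φ => φ.atoms
  | .or φ ψ => φ.atoms ∪ ψ.atoms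
  | .geq ξ => ξ.atoms
/-- Atomic propositions occurring in a K^# expression. -/
def KExpr.atoms : KExpr → Finset ℕ
  | .const _ => ∅
  | .one φ => φ.atoms
  | .count φ => φ.atoms
  | .add ξ ξ' => ξ.atoms ∪ ξ'.atoms
  | .mul _ ξ => ξ.atoms
end

/-- Conjunction, defined from ¬ and ∨. -/
def KForm.andF (φ ψ : KForm) : KForm := .neg (.or (.neg φ) (.neg ψ))

/-- Implication, defined from ¬ and ∨. -/
def KForm.impF (φ ψ : KForm) : KForm := .or (.neg φ) ψ

/-- Bi-implication, defined from ¬ and ∨. -/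
def KForm.iffF (φ ψ : KForm) : KForm := KForm.andF (φ.impF ψ) (ψ.impF φ)

/-- The modality □φ, abbreviating `0 − #(¬φ) ≥ 0`. -/
def KForm.box (φ : KForm) : KForm :=
  .geq (.add (.const 0) (.mul (-1) (.count (.neg φ))))

/-- `i`-fold iteration □^i of □. -/
def KForm.boxIter : ℕ → KForm → KForm
  | 0, φ => φ
  | i + 1, φ => KForm.box (KForm.boxIter i φ)

/-- The modality `□^{≤m} φ := ⋀_{0 ≤ i ≤ m} □^i φ`. -/
def KForm.boxUpTo : ℕ → KForm → KForm
  | 0, φ => φ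
  | m + 1, φ => KForm.andF (KForm.boxUpTo m φ) (KForm.boxIter (m + 1) φ)

/-- `#ψ = k`, abbreviating `(#ψ − k ≥ 0) ∧ (k − #ψ ≥ 0)`. -/
def KForm.countEq (ψ : KForm) (k : ℤ) : KForm :=
  KForm.andF (.geq (.add (.count ψ) (.const (-k))))
             (.geq (.add (.const k) (.mul (-1) (.count ψ))))

mutual
/-- The list of subformulas of a K^# formula (a formula is a subformula of itself). -/
def KForm.subf : KForm → List KForm
  | .atom p => [.atom p]
  | .neg φ => .neg φ :: φ.subf
  | .or φ ψ => .or φ ψ :: (φ.subf ++ ψ.subf)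
  | .geq ξ => .geq ξ :: ξ.subf
/-- The list of subformulas occurring in a K^# expression (the formulas θ occurring
as `1_θ` or `#θ`, together with their subformulas). -/
def KExpr.subf : KExpr → List KForm
  | .const _ => []
  | .one φ => φ.subf
  | .count φ => φ.subf
  | .add ξ ξ' => ξ.subf ++ ξ'.subf
  | .mul _ ξ => ξ.subf
end

/-- The expression ξ', replacing every `1_θ` by `1_{p_θ}` and every `#θ` by `#p_θ`,
where `p_θ` is the fresh atom `f θ`. -/
def KExpr.prime (f : KForm → ℕ) : KExpr → KExpr
  | .const c => .const c
  | .one φ => .one (.atom (f φ))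
  | .count φ => .count (.atom (f φ))
  | .add ξ ξ' => .add (ξ.prime f) (ξ'.prime f)
  | .mul c ξ => .mul c (ξ.prime f)

/-- The formula ψ': atoms are unchanged; ¬θ becomes ¬p_θ; θ∨θ'' becomes p_θ ∨ p_{θ''};
in ξ ≥ 0, each 1_θ becomes 1_{p_θ} and each #θ becomes #p_θ. -/
def KForm.prime (f : KForm → ℕ) : KForm → KForm
  | .atom p => .atom p
  | .neg θ => .neg (.atom (f θ))
  | .or θ θ' => .or (.atom (f θ)) (.atom (f θ'))
  | .geq ξ => .geq (ξ.prime f)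

/-- Conjunction of a list of K^# formulas. -/
def KForm.bigAnd : List KForm → KForm
  | [] => .geq (.const 0)
  | φ :: rest => KForm.andF φ (KForm.bigAnd rest)

theorem KForm.eval_andF (G : PGraph) (u : G.V) (φ ψ : KForm) :
    (KForm.andF φ ψ).eval G u = true ↔ φ.eval G u = true ∧ ψ.eval G u = true := by
  simp [KForm.andF, KForm.eval]

theorem KForm.eval_iffF (G : PGraph) (u : G.V) (φ ψ : KForm) :
    (KForm.iffF φ ψ).eval G u = true ↔ φ.eval G u = ψ.eval G u := by
  simp only [KForm.iffF, KForm.impF, KForm.eval_andF, KForm.eval]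
  cases φ.eval G u <;> cases ψ.eval G u <;> simp

theorem KForm.eval_box (G : PGraph) (u : G.V) (φ : KForm) :
    (KForm.box φ).eval G u = true ↔ ∀ v, G.E u v = true → φ.eval G v = true := by
  simp [KForm.box, KForm.eval, KExpr.eval, Finset.filter_eq_empty_iff]

theorem KForm.eval_bigAnd (G : PGraph) (u : G.V) (l : List KForm) :
    (KForm.bigAnd l).eval G u = true ↔ ∀ φ ∈ l, φ.eval G u = true := by
  induction l with
  | nil => simp [KForm.bigAnd, KForm.eval, KExpr.eval]
  | cons φ l ih => simp [KForm.bigAnd, KForm.eval_andF, ih]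

theorem KForm.eval_boxUpTo (G : PGraph) (u : G.V) (m : ℕ) (φ : KForm) :
    (KForm.boxUpTo m φ).eval G u = true ↔
      ∀ i ≤ m, (KForm.boxIter i φ).eval G u = true := by
  induction m with
  | zero => simp [KForm.boxUpTo, KForm.boxIter]
  | succ m ih =>
    rw [KForm.boxUpTo, KForm.eval_andF, ih]
    constructor
    · rintro ⟨h, h'⟩ i hi
      rcases Nat.le_succ_iff.mp hi with hi | rfl
      exacts [h i hi, h']
    · exact fun h => ⟨fun i hi => h i (by omega), h _ le_rfl⟩

theorem KForm.eval_boxIter_of_forall (G : PGraph) (φ : KForm)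
    (h : ∀ u, φ.eval G u = true) (i : ℕ) : ∀ u, (KForm.boxIter i φ).eval G u = true := by
  induction i with
  | zero => exact h
  | succ i ih => exact fun u => (KForm.eval_box G u _).mpr fun v _ => ih v

theorem KForm.eval_boxUpTo_of_edge (G : PGraph) {u v : G.V} (huv : G.E u v = true) {m : ℕ}
    {φ : KForm} (h : (KForm.boxUpTo (m + 1) φ).eval G u = true) :
    (KForm.boxUpTo m φ).eval G v = true := by
  rw [KForm.eval_boxUpTo] at h ⊢
  exact fun i hi => (KForm.eval_box G u _).mp (h (i + 1) (by omega)) v huv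

theorem KForm.mem_subf_self (φ : KForm) : φ ∈ φ.subf := by
  cases φ <;> simp [KForm.subf]

mutual
theorem KForm.subf_subset_of_mem {ψ : KForm} : ∀ φ : KForm, ψ ∈ φ.subf → ψ.subf ⊆ φ.subf
  | .atom p, h => by
      simp only [KForm.subf, List.mem_singleton] at h
      subst h
      exact List.Subset.refl _
  | .neg φ, h => by
      rcases List.mem_cons.mp h with rfl | h
      · exact List.Subset.refl _
      · exact List.subset_cons_of_subset _ (KForm.subf_subset_of_mem φ h)
  | .or φ φ', h => by
      rcases List.mem_cons.mp h with rfl | h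
      · exact List.Subset.refl _
      · apply List.subset_cons_of_subset
        rcases List.mem_append.mp h with h | h
        · exact List.subset_append_of_subset_left _ (KForm.subf_subset_of_mem φ h)
        · exact List.subset_append_of_subset_right _ (KForm.subf_subset_of_mem φ' h)
  | .geq ξ, h => by
      rcases List.mem_cons.mp h with rfl | h
      · exact List.Subset.refl _
      · exact List.subset_cons_of_subset _ (KExpr.subf_subset_of_mem ξ h)
theorem KExpr.subf_subset_of_mem {ψ : KForm} : ∀ ξ : KExpr, ψ ∈ ξ.subf → ψ.subf ⊆ ξ.subf
  | .const _, h => by simp [KExpr.subf] at h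
  | .one φ, h => KForm.subf_subset_of_mem φ h
  | .count φ, h => KForm.subf_subset_of_mem φ h
  | .add ξ ξ', h => by
      rcases List.mem_append.mp h with h | h
      · exact List.subset_append_of_subset_left _ (KExpr.subf_subset_of_mem ξ h)
      · exact List.subset_append_of_subset_right _ (KExpr.subf_subset_of_mem ξ' h)
  | .mul _ ξ, h => KExpr.subf_subset_of_mem ξ h
end

mutual
theorem KForm.mem_atoms_of_atom_mem_subf {p : ℕ} :
    ∀ φ : KForm, KForm.atom p ∈ φ.subf → p ∈ φ.atoms
  | .atom _, h => by simpa [KForm.subf, KForm.atoms] using h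
  | .neg φ, h => KForm.mem_atoms_of_atom_mem_subf φ (by simpa [KForm.subf] using h)
  | .or φ φ', h => by
      simp only [KForm.subf, List.mem_cons, List.mem_append, reduceCtorEq, false_or] at h
      exact Finset.mem_union.mpr (h.imp (KForm.mem_atoms_of_atom_mem_subf φ)
        (KForm.mem_atoms_of_atom_mem_subf φ'))
  | .geq ξ, h => KExpr.mem_atoms_of_atom_mem_subf ξ (by simpa [KForm.subf] using h)
theorem KExpr.mem_atoms_of_atom_mem_subf {p : ℕ} :
    ∀ ξ : KExpr, KForm.atom p ∈ ξ.subf → p ∈ ξ.atoms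
  | .const _, h => by simp [KExpr.subf] at h
  | .one φ, h => KForm.mem_atoms_of_atom_mem_subf φ h
  | .count φ, h => KForm.mem_atoms_of_atom_mem_subf φ h
  | .add ξ ξ', h => Finset.mem_union.mpr ((List.mem_append.mp h).imp
      (KExpr.mem_atoms_of_atom_mem_subf ξ) (KExpr.mem_atoms_of_atom_mem_subf ξ'))
  | .mul _ ξ, h => KExpr.mem_atoms_of_atom_mem_subf ξ h
end

/-- The graph `G` with its labeling replaced by `L`. -/
def PGraph.withLabel (G : PGraph) (L : G.V → ℕ → Bool) : PGraph := { G with label := L }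

theorem KExpr.eval_withLabel_prime (G : PGraph) (L : G.V → ℕ → Bool) (f : KForm → ℕ) (u : G.V) :
    ∀ ξ : KExpr, (∀ v, ∀ θ ∈ ξ.subf, L v (f θ) = θ.eval G v) →
      (ξ.prime f).eval (G.withLabel L) u = ξ.eval G u
  | .const _, _ => rfl
  | .one φ, h => by
      have := h u φ φ.mem_subf_self
      simp [KExpr.prime, KExpr.eval, KForm.eval, PGraph.withLabel, this]
  | .count φ, h => by
      have := fun v => h v φ φ.mem_subf_self
      simp [KExpr.prime, KExpr.eval, KForm.eval, PGraph.withLabel, this]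
  | .add ξ ξ', h => congrArg₂ (· + ·)
      (KExpr.eval_withLabel_prime G L f u ξ fun v θ hθ => h v θ (List.mem_append_left _ hθ))
      (KExpr.eval_withLabel_prime G L f u ξ' fun v θ hθ => h v θ (List.mem_append_right _ hθ))
  | .mul c ξ, h => congrArg (c * ·) (KExpr.eval_withLabel_prime G L f u ξ h)

theorem KForm.eval_withLabel_prime (G : PGraph) (L : G.V → ℕ → Bool) (f : KForm → ℕ) (u : G.V)
    (ψ : KForm) (h : ∀ v, ∀ θ ∈ ψ.subf, L v (f θ) = θ.eval G v)
    (hatom : ∀ p, KForm.atom p ∈ ψ.subf → L u p = G.label u p) :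
    (ψ.prime f).eval (G.withLabel L) u = ψ.eval G u := by
  cases ψ with
  | atom p => exact hatom p (KForm.mem_subf_self _)
  | neg θ => exact congrArg (!·) (h u θ (by simp [KForm.subf, KForm.mem_subf_self]))
  | or θ θ' =>
    exact congrArg₂ (· || ·) (h u θ (by simp [KForm.subf, KForm.mem_subf_self]))
      (h u θ' (by simp [KForm.subf, KForm.mem_subf_self]))
  | geq ξ =>
    have := KExpr.eval_withLabel_prime G L f u ξ fun v θ hθ => h v θ (List.mem_cons_of_mem _ hθ)
    simp [KForm.prime, KForm.eval, this]

mutual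
theorem KForm.label_eq_eval (G : PGraph) (f : KForm → ℕ) : ∀ (ψ : KForm) (k : ℕ) (u : G.V),
    (∀ θ ∈ ψ.subf, (KForm.boxUpTo k (KForm.iffF (.atom (f θ)) (θ.prime f))).eval G u = true) →
    ψ.md ≤ k → G.label u (f ψ) = ψ.eval G u
  | ψ, k, u, h, hk => by
      have hψ := (KForm.eval_iffF G u _ _).mp
        ((KForm.eval_boxUpTo G u k _).mp (h ψ ψ.mem_subf_self) 0 (Nat.zero_le _))
      refine Eq.trans hψ ?_
      cases ψ with
      | atom p => rfl
      | neg θ =>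
        exact congrArg (!·) (KForm.label_eq_eval G f θ k u
          (fun χ hχ => h χ (List.mem_cons_of_mem _ hχ)) hk)
      | or θ θ' =>
        have hmd := max_le_iff.mp hk
        exact congrArg₂ (· || ·)
          (KForm.label_eq_eval G f θ k u (fun χ hχ => h χ
            (List.mem_cons_of_mem _ (List.mem_append_left _ hχ))) hmd.1)
          (KForm.label_eq_eval G f θ' k u (fun χ hχ => h χ
            (List.mem_cons_of_mem _ (List.mem_append_right _ hχ))) hmd.2)
      | geq ξ =>
        have := KExpr.eval_prime G f ξ k u (fun χ hχ => h χ (List.mem_cons_of_mem _ hχ)) hk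
        simp [KForm.prime, KForm.eval, this]
theorem KExpr.eval_prime (G : PGraph) (f : KForm → ℕ) : ∀ (ξ : KExpr) (k : ℕ) (u : G.V),
    (∀ θ ∈ ξ.subf, (KForm.boxUpTo k (KForm.iffF (.atom (f θ)) (θ.prime f))).eval G u = true) →
    ξ.md ≤ k → (ξ.prime f).eval G u = ξ.eval G u
  | .const _, _, _, _, _ => rfl
  | .one φ, k, u, h, hk => by
      have := KForm.label_eq_eval G f φ k u h hk
      simp [KExpr.prime, KExpr.eval, KForm.eval, this]
  | .count φ, 0, u, h, hk => by simp [KExpr.md] at hk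
  | .count φ, k + 1, u, h, hk => by
      have hsucc : ∀ v, G.E u v = true → G.label v (f φ) = φ.eval G v := fun v hv =>
        KForm.label_eq_eval G f φ k v
          (fun θ hθ => KForm.eval_boxUpTo_of_edge G hv (h θ hθ)) (Nat.le_of_succ_le_succ hk)
      simp only [KExpr.prime, KExpr.eval, KForm.eval]
      congr 2
      ext v
      by_cases hv : G.E u v = true <;> simp [hv, hsucc]
  | .add ξ ξ', k, u, h, hk => congrArg₂ (· + ·)
      (KExpr.eval_prime G f ξ k u (fun θ hθ => h θ (List.mem_append_left _ hθ))
        (max_le_iff.mp hk).1)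
      (KExpr.eval_prime G f ξ' k u (fun θ hθ => h θ (List.mem_append_right _ hθ))
        (max_le_iff.mp hk).2)
  | .mul c ξ, k, u, h, hk => congrArg (c * ·) (KExpr.eval_prime G f ξ k u h hk)
end

/-- With distinct fresh atoms `f ψ` for each subformula ψ of φ,
φ is satisfiable iff `p_φ ∧ ⋀_{ψ ∈ sub(φ)} □^{≤md(φ)}(p_ψ ↔ ψ')` is satisfiable. -/
theorem tseitin_equisatisfiable (φ : KForm) (f : KForm → ℕ)
    (hinj : ∀ ψ ∈ φ.subf, ∀ θ ∈ φ.subf, f ψ = f θ → ψ = θ)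
    (hfresh : ∀ ψ ∈ φ.subf, f ψ ∉ φ.atoms) :
    φ.satisfiable ↔
      (KForm.andF (.atom (f φ))
        (KForm.bigAnd (φ.subf.map (fun ψ =>
          KForm.boxUpTo φ.md (KForm.iffF (.atom (f ψ)) (ψ.prime f)))))).satisfiable := by
  classical
  constructor
  · rintro ⟨G, u, hu⟩
    let L : G.V → ℕ → Bool := fun v p =>
      if h : ∃ θ ∈ φ.subf, f θ = p then h.choose.eval G v else G.label v p
    have hL : ∀ v, ∀ θ ∈ φ.subf, L v (f θ) = θ.eval G v := fun v θ hθ => by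
      have h : ∃ χ ∈ φ.subf, f χ = f θ := ⟨θ, hθ, rfl⟩
      have heq : h.choose = θ := hinj _ h.choose_spec.1 _ hθ h.choose_spec.2
      simp only [L, dif_pos h, heq]
    have hLatom : ∀ v p, KForm.atom p ∈ φ.subf → L v p = G.label v p := fun v p hp => by
      refine dif_neg ?_
      rintro ⟨θ, hθ, rfl⟩
      exact hfresh θ hθ (KForm.mem_atoms_of_atom_mem_subf φ hp)
    refine ⟨G.withLabel L, u, (KForm.eval_andF _ _ _ _).mpr
      ⟨(hL u φ φ.mem_subf_self).trans hu, (KForm.eval_bigAnd _ _ _).mpr ?_⟩⟩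
    intro χ hχ
    obtain ⟨ψ, hψ, rfl⟩ := List.mem_map.mp hχ
    have hsub := KForm.subf_subset_of_mem φ hψ
    refine (KForm.eval_boxUpTo _ _ _ _).mpr fun i _ =>
      KForm.eval_boxIter_of_forall (G.withLabel L) _
        (fun v => (KForm.eval_iffF (G.withLabel L) v _ _).mpr ?_) i u
    exact (hL v ψ hψ).trans (KForm.eval_withLabel_prime G L f v ψ
      (fun w θ hθ => hL w θ (hsub hθ)) fun p hp => hLatom v p (hsub hp)).symm
  · rintro ⟨G, u, hu⟩
    obtain ⟨hφ, hall⟩ := (KForm.eval_andF _ _ _ _).mp hu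
    refine ⟨G, u, (KForm.label_eq_eval G f φ φ.md u (fun θ hθ => ?_) le_rfl).symm.trans hφ⟩
    exact (KForm.eval_bigAnd _ _ _).mp hall _ (List.mem_map_of_mem hθ)
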